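/- There exists a constant C > 0 such that for all n, k ∈ ℕ with n, k ≥ 2, every z ∈ ℤ² adjacent to the square Q(0,k) (i.e., at graph distance 1 from Q(0,k)), the simple random walk on ℤ² started at z satisfies P_z[ ∂R(n) ∩ Q(0,k) ≠ ∅ ] ≤ C · (log k)² / log n. -/

import Mathlib

open Real

/-- A single step of the simple random walk on `ℤ^d`: the pair `(i, b)` encodes a move by
`+eᵢ` (if `b = true`) or `-eᵢ` (if `b = false`).  The uniform distribution on `Fin d × Bool`
corresponds to the uniform distribution on the `2d` unit vectors. -/
def step {d : ℕ} (a : Fin d × Bool) : Fin d → ℤ :=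
  fun j => if j = a.1 then (if a.2 then 1 else -1) else 0

/-- The position `S(k)` of the walk started at `z` after `k` steps, driven by the
sequence of i.i.d. uniform steps `ω : Fin n → Fin d × Bool` (meaningful for `k ≤ n`). -/
def walk {d n : ℕ} (z : Fin d → ℤ) (ω : Fin n → Fin d × Bool) (k : ℕ) : Fin d → ℤ :=
  z + ∑ i ∈ Finset.univ.filter (fun i : Fin n => (i : ℕ) < k), step (ω i)

/-- Probability of an event for the `n`-step simple random walk on `ℤ^d`:
the driving step sequences are uniform among the `(2d)^n` possibilities. -/
noncomputable def prW (d n : ℕ) (E : Set (Fin n → Fin d × Bool)) : ℝ :=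
  E.ncard / (2 * d) ^ n

/-- Expectation of a random variable of the `n`-step simple random walk on `ℤ^d`. -/
noncomputable def exW (d n : ℕ) (f : (Fin n → Fin d × Bool) → ℝ) : ℝ :=
  (∑ ω : Fin n → Fin d × Bool, f ω) / (2 * d) ^ n

/-- Shannon entropy (base 2) of a random variable `X` of the `n`-step walk:
`H(X) = ∑ₐ -P[X = a] · log₂ P[X = a]`. -/
noncomputable def entW {α : Type*} (d n : ℕ) (X : (Fin n → Fin d × Bool) → α) : ℝ :=
  ∑' a : α, -(prW d n {ω | X ω = a} * logb 2 (prW d n {ω | X ω = a}))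

/-- The range `R(n) = {S(0), …, S(n)}` of the `n`-step walk started at `z`. -/
def rangeW {d n : ℕ} (z : Fin d → ℤ) (ω : Fin n → Fin d × Bool) : Finset (Fin d → ℤ) :=
  (Finset.range (n + 1)).image (walk z ω)

/-- The inner boundary `∂A` of a finite set `A ⊆ ℤ^d`: the points of `A` adjacent
(at graph distance 1, i.e. reachable by a single step) to some vertex of the complement. -/
def innerBdry {d : ℕ} (A : Finset (Fin d → ℤ)) : Finset (Fin d → ℤ) :=
  A.filter fun x => ∃ a : Fin d × Bool, x + step a ∉ A

/-- The Euclidean (`L²`) norm on `ℤ^d`. -/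
noncomputable def eNorm {d : ℕ} (x : Fin d → ℤ) : ℝ :=
  Real.sqrt (∑ i, ((x i : ℝ)) ^ 2)

/-- The square `Q(z,k) = {z + (j,j′) : −k ≤ j, j′ ≤ k}` of side length `2k+1` centered at `z`. -/
def square (z : Fin 2 → ℤ) (k : ℕ) : Set (Fin 2 → ℤ) :=
  {w | ∀ i, |w i - z i| ≤ (k : ℤ)}

/-- The probability that the `t`-step walk started at `x` leaves some point of `B` unvisited. -/
noncomputable def missProb : ℕ → (Fin 2 → ℤ) → Finset (Fin 2 → ℤ) → ℝ
  | 0, x, B => if B ⊆ {x} then 0 else 1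
  | t + 1, x, B => (∑ a : Fin 2 × Bool, missProb t (x + step a) (B.erase x)) / 4

lemma card_steps : Fintype.card (Fin 2 × Bool) = 4 := by simp

lemma avg_le_of_forall_le {f : Fin 2 × Bool → ℝ} {c : ℝ} (h : ∀ a, f a ≤ c) :
    (∑ a, f a) / 4 ≤ c := by
  have := Finset.sum_le_card_nsmul Finset.univ f c (fun a _ => h a)
  rw [Finset.card_univ, card_steps] at this
  simp only [nsmul_eq_mul, Nat.cast_ofNat] at this
  linarith

lemma avg_le_avg {f g : Fin 2 × Bool → ℝ} (h : ∀ a, f a ≤ g a) :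
    (∑ a, f a) / 4 ≤ (∑ a, g a) / 4 := by
  have := Finset.sum_le_sum (s := Finset.univ) (fun a _ => h a)
  linarith

lemma avg_add_const (f : Fin 2 × Bool → ℝ) (c : ℝ) :
    (∑ a, (f a + c)) / 4 = (∑ a, f a) / 4 + c := by
  rw [Finset.sum_add_distrib, Finset.sum_const, Finset.card_univ, card_steps]
  simp only [nsmul_eq_mul, Nat.cast_ofNat]
  ring

lemma missProb_nonneg (t : ℕ) (x : Fin 2 → ℤ) (B : Finset (Fin 2 → ℤ)) : 0 ≤ missProb t x B := by
  induction t generalizing x B with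
  | zero => unfold missProb; split_ifs <;> norm_num
  | succ t ih =>
    unfold missProb
    exact div_nonneg (Finset.sum_nonneg fun a _ => ih _ _) (by norm_num)

lemma missProb_le_one (t : ℕ) (x : Fin 2 → ℤ) (B : Finset (Fin 2 → ℤ)) : missProb t x B ≤ 1 := by
  induction t generalizing x B with
  | zero => unfold missProb; split_ifs <;> norm_num
  | succ t ih => exact avg_le_of_forall_le fun a => ih _ _

lemma missProb_mono {B B' : Finset (Fin 2 → ℤ)} (h : B ⊆ B') (t : ℕ) (x : Fin 2 → ℤ) :
    missProb t x B ≤ missProb t x B' := by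
  induction t generalizing x B B' with
  | zero =>
    unfold missProb
    by_cases h' : B' ⊆ {x}
    · simp [h', h.trans h']
    · simp only [h', if_false]; split_ifs <;> norm_num
  | succ t ih => exact avg_le_avg fun a => ih (Finset.erase_subset_erase x h) _

lemma missProb_succ_le (t : ℕ) (x : Fin 2 → ℤ) (B : Finset (Fin 2 → ℤ)) :
    missProb (t + 1) x B ≤ missProb t x B := by
  induction t generalizing x B with
  | zero =>
    by_cases h : B ⊆ {x}
    · have : B.erase x = ∅ := by
        rw [← Finset.subset_empty]
        intro y hy
        rw [Finset.mem_erase] at hy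
        exact absurd (Finset.mem_singleton.1 (h hy.2)) hy.1
      simp [missProb, h, this]
    · have := missProb_le_one 1 x B
      simpa [missProb, h] using this
  | succ t ih => exact avg_le_avg fun a => ih _ _

lemma missProb_antitone (x : Fin 2 → ℤ) (B : Finset (Fin 2 → ℤ)) :
    Antitone fun t => missProb t x B :=
  antitone_nat_of_succ_le fun t => missProb_succ_le t x B

lemma missProb_empty (t : ℕ) (x : Fin 2 → ℤ) : missProb t x ∅ = 0 := by
  induction t generalizing x with
  | zero => simp [missProb]
  | succ t ih => simp [missProb, ih]

lemma missProb_erase_self (t : ℕ) (x : Fin 2 → ℤ) (B : Finset (Fin 2 → ℤ)) :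
    missProb t x (B.erase x) = missProb t x B := by
  cases t with
  | zero =>
    have : B.erase x ⊆ {x} ↔ B ⊆ {x} := by
      rw [← Finset.subset_insert_iff]; simp
    simp only [missProb, this]
  | succ t => simp [missProb]

lemma missProb_self (t : ℕ) (x : Fin 2 → ℤ) : missProb t x {x} = 0 := by
  rw [← missProb_erase_self, Finset.erase_singleton, missProb_empty]

lemma missProb_zero_singleton {x y : Fin 2 → ℤ} (h : x ≠ y) : missProb 0 x {y} = 1 := by
  simp [missProb, h.symm]

lemma missProb_succ_singleton (t : ℕ) {x y : Fin 2 → ℤ} (h : x ≠ y) :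
    missProb (t + 1) x {y} = (∑ a, missProb t (x + step a) {y}) / 4 := by
  simp [missProb, Finset.erase_eq_of_notMem, h]

/-- The strong Markov property at the hitting time of `y`. -/
lemma missProb_le_of_hit {t : ℕ} {y : Fin 2 → ℤ} {B : Finset (Fin 2 → ℤ)} {c : ℝ}
    (hc : missProb t y B ≤ c) (s : ℕ) (x : Fin 2 → ℤ) :
    missProb (s + t) x B ≤ missProb s x {y} + c := by
  have hc0 : 0 ≤ c := (missProb_nonneg _ _ _).trans hc
  induction s generalizing x B with
  | zero =>
    rw [zero_add]
    by_cases h : x = y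
    · subst h; rw [missProb_self]; linarith
    · rw [missProb_zero_singleton h]
      linarith [missProb_le_one t x B]
  | succ s ih =>
    by_cases h : x = y
    · subst h
      rw [missProb_self]
      have := missProb_antitone x B (show t ≤ s + 1 + t by omega)
      simp only at this
      linarith
    · rw [missProb_succ_singleton s h, ← avg_add_const, show s + 1 + t = (s + t) + 1 by omega]
      exact avg_le_avg fun a => ih ((missProb_mono (Finset.erase_subset x B) _ _).trans hc) _

lemma abs_step_le (a : Fin 2 × Bool) (i : Fin 2) : |step a i| ≤ 1 := by
  unfold step; split_ifs <;> simp

/-- The Markov property at the deterministic time `L`. -/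
lemma missProb_le_of_markov {t : ℕ} {α β : ℝ} (hβ : 0 ≤ β) (L : ℕ) (x : Fin 2 → ℤ)
    (B : Finset (Fin 2 → ℤ))
    (h : ∀ B' ⊆ B, ∀ w : Fin 2 → ℤ, (∀ i, |w i - x i| ≤ (L : ℤ)) →
      missProb t w B' ≤ α + β * B'.card) :
    missProb (L + t) x B ≤ α + β * ∑ y ∈ B, missProb L x {y} := by
  induction L generalizing x B with
  | zero =>
    rw [zero_add, ← missProb_erase_self]
    refine (h _ (Finset.erase_subset x B) x (by simp)).trans ?_
    gcongr
    rw [Finset.card_eq_sum_ones]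
    push_cast
    rw [← Finset.sum_erase B (missProb_self 0 x)]
    refine Finset.sum_le_sum fun y hy => ?_
    rw [missProb_zero_singleton (Finset.ne_of_mem_erase hy).symm]
  | succ L ih =>
    rw [show L + 1 + t = (L + t) + 1 by omega, missProb]
    have key : ∀ a, missProb (L + t) (x + step a) (B.erase x) ≤
        β * ∑ y ∈ B.erase x, missProb L (x + step a) {y} + α := by
      intro a
      rw [add_comm _ α]
      refine ih _ _ fun B' hB' w hw => h B' (hB'.trans (Finset.erase_subset _ _)) w fun i => ?_
      have h1 := hw i
      have h2 := abs_step_le a i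
      rw [Pi.add_apply] at h1
      rw [abs_le] at h1 h2 ⊢
      push_cast
      constructor <;> linarith [h1.1, h1.2, h2.1, h2.2]
    refine (avg_le_avg key).trans ?_
    rw [avg_add_const, ← Finset.mul_sum, Finset.sum_comm, add_comm, mul_div_assoc, Finset.sum_div]
    refine le_of_eq ?_
    rw [← Finset.sum_erase B (missProb_self (L + 1) x)]
    congr 2
    refine Finset.sum_congr rfl fun y hy => ?_
    rw [missProb_succ_singleton L (Finset.ne_of_mem_erase hy).symm]

lemma missProb_le_sum (t : ℕ) (x : Fin 2 → ℤ) (B : Finset (Fin 2 → ℤ)) :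
    missProb t x B ≤ ∑ y ∈ B, missProb t x {y} := by
  have := missProb_le_of_markov (t := 0) (α := 0) (β := 1) zero_le_one t x B
    (fun B' _ w _ => by
      by_cases h : B' ⊆ {w}
      · simp [missProb, h]
      · have : 1 ≤ B'.card := Finset.card_pos.2 (Finset.nonempty_iff_ne_empty.2 (by
          rintro rfl; simp at h))
        simp only [missProb, h, if_false, zero_add, one_mul]
        exact_mod_cast this)
  simpa using this

/-! The link between `missProb` and the walk on path space. -/

lemma walk_cons_succ {n : ℕ} (z : Fin 2 → ℤ) (a : Fin 2 × Bool) (ω : Fin n → Fin 2 × Bool) (k : ℕ) :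
    walk z (Fin.cons a ω : Fin (n + 1) → Fin 2 × Bool) (k + 1) = walk (z + step a) ω k := by
  unfold walk
  rw [Finset.sum_filter, Finset.sum_filter, Fin.sum_univ_succ]
  simp [add_assoc]

lemma walk_zero {n : ℕ} (z : Fin 2 → ℤ) (ω : Fin n → Fin 2 × Bool) : walk z ω 0 = z := by
  simp [walk]

lemma rangeW_cons {n : ℕ} (z : Fin 2 → ℤ) (a : Fin 2 × Bool) (ω : Fin n → Fin 2 × Bool) :
    rangeW z (Fin.cons a ω : Fin (n + 1) → Fin 2 × Bool) =
      insert z (rangeW (z + step a) ω) := by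
  unfold rangeW
  rw [Finset.range_add_one', Finset.image_insert, walk_zero, Finset.map_eq_image,
    Finset.image_image]
  congr 1
  refine Finset.image_congr fun k _ => ?_
  exact walk_cons_succ z a ω k

open Classical in
lemma prW_eq_sum (n : ℕ) (E : Set (Fin n → Fin 2 × Bool)) :
    prW 2 n E = (∑ ω, if ω ∈ E then (1 : ℝ) else 0) / 4 ^ n := by
  unfold prW
  rw [Set.ncard_eq_toFinset_card', Finset.sum_boole]
  norm_num

lemma prW_not_subset_rangeW (n : ℕ) (z : Fin 2 → ℤ) (B : Finset (Fin 2 → ℤ)) :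
    prW 2 n {ω | ¬ B ⊆ rangeW z ω} = missProb n z B := by
  rw [prW_eq_sum]
  induction n generalizing z B with
  | zero =>
    have hr : ∀ ω : Fin 0 → Fin 2 × Bool, rangeW z ω = {z} := fun ω => by
      simp [rangeW, walk_zero]
    simp only [missProb, Set.mem_ofPred_eq, hr]
    by_cases h : B ⊆ {z}
    · simp only [h, not_true_eq_false, if_false, Finset.sum_const_zero, zero_div, if_true]
    · simp only [h, not_false_eq_true, if_false, if_true, Finset.sum_const, Finset.card_univ]
      simp
  | succ n ih =>
    rw [missProb, ← (Fin.consEquiv fun _ => Fin 2 × Bool).sum_comp, Fintype.sum_prod_type,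
      pow_succ, ← div_div, Finset.sum_div]
    congr 1
    refine Finset.sum_congr rfl fun a _ => ?_
    rw [← ih]
    congr 1
    refine Finset.sum_congr rfl fun ω _ => ?_
    simp only [Fin.consEquiv, Equiv.coe_fn_mk, Set.mem_ofPred_eq, rangeW_cons,
      Finset.subset_insert_iff]
    split_ifs <;> rfl

lemma prW_mono {n : ℕ} {E F : Set (Fin n → Fin 2 × Bool)} (h : E ⊆ F) : prW 2 n E ≤ prW 2 n F := by
  unfold prW
  gcongr
  exact Set.toFinite F

/-! Transition probabilities: in the rotated coordinates `x₀ ± x₁` the planar walk is a pair of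
independent one-dimensional walks. -/

/-- The `n`-step transition probability of the one-dimensional simple random walk. -/
noncomputable def lineProb : ℕ → ℤ → ℝ
  | 0, u => if u = 0 then 1 else 0
  | n + 1, u => (lineProb n (u + 1) + lineProb n (u - 1)) / 2

/-- The `n`-step transition probability of the planar simple random walk. -/
noncomputable def planeProb (n : ℕ) (x : Fin 2 → ℤ) : ℝ :=
  lineProb n (x 0 + x 1) * lineProb n (x 0 - x 1)

lemma lineProb_nonneg (n : ℕ) (u : ℤ) : 0 ≤ lineProb n u := by
  induction n generalizing u with
  | zero => unfold lineProb; split_ifs <;> norm_num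
  | succ n ih =>
    unfold lineProb
    linarith [ih (u + 1), ih (u - 1)]

lemma lineProb_neg (n : ℕ) (u : ℤ) : lineProb n (-u) = lineProb n u := by
  induction n generalizing u with
  | zero => simp [lineProb]
  | succ n ih =>
    unfold lineProb
    rw [← ih (u + 1), ← ih (u - 1), add_comm]
    congr 3 <;> ring

lemma lineProb_eq_zero (n : ℕ) {u : ℤ} (h : (n : ℤ) < |u|) : lineProb n u = 0 := by
  induction n generalizing u with
  | zero => simp [lineProb]; rintro rfl; simp at h
  | succ n ih =>
    push_cast at h
    unfold lineProb
    rw [lt_abs] at h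
    rw [ih, ih]
    · simp
    all_goals rw [lt_abs]; omega

lemma lineProb_eq_choose (n i : ℕ) : lineProb n (2 * i - n) = n.choose i / 2 ^ n := by
  induction n generalizing i with
  | zero => cases i <;> simp [lineProb]; omega
  | succ n ih =>
    unfold lineProb
    cases i with
    | zero =>
      rw [lineProb_eq_zero n (u := 2 * ((0 : ℕ) : ℤ) - ((n + 1 : ℕ) : ℤ) - 1) (by
        rw [lt_abs]; push_cast; omega)]
      have := ih 0
      rw [show 2 * ((0 : ℕ) : ℤ) - ((n + 1 : ℕ) : ℤ) + 1 = 2 * ((0 : ℕ) : ℤ) - n by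
        push_cast; ring, this]
      rw [pow_succ]
      simp
      ring
    | succ i =>
      rw [show 2 * ((i + 1 : ℕ) : ℤ) - ((n + 1 : ℕ) : ℤ) + 1 = 2 * ((i + 1 : ℕ) : ℤ) - n by
        push_cast; ring, ih, show 2 * ((i + 1 : ℕ) : ℤ) - ((n + 1 : ℕ) : ℤ) - 1 = 2 * (i : ℤ) - n by
        push_cast; ring, ih, Nat.choose_succ_succ, pow_succ]
      push_cast
      ring

lemma lineProb_two_mul (j s : ℕ) :
    lineProb (2 * j) (2 * s) = (2 * j).choose (j + s) / 4 ^ j := by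
  have := lineProb_eq_choose (2 * j) (j + s)
  rw [pow_mul] at this
  norm_num at this
  rw [← this]
  congr 1
  ring

lemma lineProb_two_mul_le (j s : ℕ) : lineProb (2 * j) (2 * s) ≤ lineProb (2 * j) 0 := by
  have h0 := lineProb_two_mul j 0
  simp only [Nat.cast_zero, mul_zero, add_zero] at h0
  rw [h0, lineProb_two_mul]
  gcongr
  exact Nat.choose_le_centralBinom (j + s) j

lemma lineProb_two_mul_ge (j s : ℕ) :
    lineProb (2 * j) 0 * (1 - (s : ℝ) ^ 2 / (j + 1)) ≤ lineProb (2 * j) (2 * s) := by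
  induction s with
  | zero => simp
  | succ s ih =>
    have hq : lineProb (2 * j) (2 * ((s + 1 : ℕ) : ℤ)) * (j + s + 1) =
        lineProb (2 * j) (2 * s) * ((j - s : ℕ) : ℝ) := by
      rw [lineProb_two_mul, lineProb_two_mul]
      have := Nat.choose_succ_right_eq (2 * j) (j + s)
      rw [show 2 * j - (j + s) = j - s by omega] at this
      have h2 : (((2 * j).choose (j + (s + 1)) : ℕ) : ℝ) * (j + s + 1) =
          (2 * j).choose (j + s) * ((j - s : ℕ) : ℝ) := by exact_mod_cast this
      rw [div_mul_eq_mul_div, h2, div_mul_eq_mul_div]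
    have hj : (j : ℝ) - s ≤ ((j - s : ℕ) : ℝ) := by
      rw [sub_le_iff_le_add]; exact_mod_cast (by omega : j ≤ j - s + s)
    have hle := lineProb_two_mul_le j s
    set q0 := lineProb (2 * j) 0
    set q := lineProb (2 * j) (2 * s)
    set q1 := lineProb (2 * j) (2 * ((s + 1 : ℕ) : ℤ))
    have hq0 : 0 ≤ q := lineProb_nonneg _ _
    have hpos : (0 : ℝ) < j + s + 1 := by positivity
    have h1 : q - q * ((2 * s + 1) / (j + s + 1)) ≤ q1 := by
      have : q * (j - s) ≤ q1 * (j + s + 1) := by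
        rw [hq]; exact mul_le_mul_of_nonneg_left hj hq0
      rw [← div_le_iff₀ hpos] at this
      refine le_trans (le_of_eq ?_) this
      field_simp
      ring
    have h2 : q * ((2 * s + 1) / (j + s + 1)) ≤ q0 * ((2 * s + 1) / (j + 1)) := by
      have : (0 : ℝ) ≤ s := Nat.cast_nonneg s
      gcongr <;> linarith
    have h3 : q0 * (1 - ((s + 1 : ℕ) : ℝ) ^ 2 / (j + 1)) =
        q0 * (1 - (s : ℝ) ^ 2 / (j + 1)) - q0 * ((2 * s + 1) / (j + 1)) := by
      push_cast; ring
    rw [h3]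
    linarith

lemma lineProb_zero_odd (j : ℕ) : lineProb (2 * j + 1) 0 = 0 := by
  have key : ∀ n : ℕ, ∀ u : ℤ, Odd (u + n) → lineProb n u = 0 := by
    intro n
    induction n with
    | zero => intro u hu; simp [lineProb]; rintro rfl; simp at hu
    | succ n ih =>
      intro u hu
      push_cast at hu
      unfold lineProb
      rw [ih (u + 1) (by rwa [show u + 1 + n = u + (n + 1) by ring]), ih (u - 1) (by
        rw [show u - 1 + n = u + (n + 1) - 2 by ring]
        exact hu.sub_even even_two)]
      simp
  exact key _ _ ⟨j, by push_cast; ring⟩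

lemma lineProb_zero_sq_succ (j : ℕ) :
    lineProb (2 * (j + 1)) 0 * (2 * j + 2) = lineProb (2 * j) 0 * (2 * j + 1) := by
  have h := fun i => lineProb_two_mul i 0
  simp only [Nat.cast_zero, mul_zero, add_zero] at h
  rw [h, h]
  have h2 : (((j + 1) * (2 * (j + 1)).choose (j + 1) : ℕ) : ℝ) =
    ((2 * (2 * j + 1) * (2 * j).choose j : ℕ) : ℝ) := by
    exact_mod_cast Nat.succ_mul_centralBinom_succ j
  push_cast at h2
  rw [pow_succ]
  field_simp
  linarith

lemma lineProb_zero_sq_le (j : ℕ) : lineProb (2 * j) 0 ^ 2 ≤ 1 / (j + 1) := by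
  have key : lineProb (2 * j) 0 ^ 2 * (2 * j + 1) ≤ 1 := by
    induction j with
    | zero => simp [lineProb]
    | succ j ih =>
      have h := lineProb_zero_sq_succ j
      set c := lineProb (2 * j) 0
      set d := lineProb (2 * (j + 1)) 0
      push_cast
      have h2 : d ^ 2 * (2 * j + 2) ^ 2 = c ^ 2 * (2 * j + 1) ^ 2 := by
        rw [← mul_pow, h, mul_pow]
      have h3 : d ^ 2 * (2 * (j + 1) + 1) * (2 * j + 2) ^ 2 ≤ 1 * (2 * (j : ℝ) + 2) ^ 2 := by
        calc d ^ 2 * (2 * ((j : ℝ) + 1) + 1) * (2 * (j : ℝ) + 2) ^ 2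
            = (c ^ 2 * (2 * (j : ℝ) + 1)) * ((2 * (j : ℝ) + 1) * (2 * (j : ℝ) + 3)) := by
              linear_combination (2 * (j : ℝ) + 3) * h2
          _ ≤ 1 * ((2 * (j : ℝ) + 1) * (2 * (j : ℝ) + 3)) := by gcongr
          _ ≤ _ := by nlinarith
      exact le_of_mul_le_mul_right h3 (by positivity)
  rw [le_div_iff₀ (by positivity)]
  nlinarith [sq_nonneg (lineProb (2 * j) 0), Nat.cast_nonneg (α := ℝ) j]

lemma lineProb_zero_sq_ge (j : ℕ) : 1 / (4 * (j + 1)) ≤ lineProb (2 * j) 0 ^ 2 := by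
  have key : ∀ j : ℕ, 1 / 4 ≤ lineProb (2 * (j + 1)) 0 ^ 2 * (j + 1) := by
    intro j
    induction j with
    | zero => norm_num [lineProb]
    | succ j ih =>
      have h := lineProb_zero_sq_succ (j + 1)
      set c := lineProb (2 * (j + 1)) 0
      set d := lineProb (2 * (j + 1 + 1)) 0
      push_cast at h ⊢
      have h2 : d ^ 2 * (2 * (j + 1) + 2) ^ 2 = c ^ 2 * (2 * (j + 1) + 1) ^ 2 := by
        rw [← mul_pow, h, mul_pow]
      have h4 : d ^ 2 * ((j : ℝ) + 1 + 1) * (4 * (j + 1 + 1) * (j + 1)) =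
          c ^ 2 * (j + 1) * (2 * (j + 1) + 1) ^ 2 := by
        linear_combination ((j : ℝ) + 1) * h2
      have h3 : 1 / 4 * (4 * ((j : ℝ) + 1 + 1) * (j + 1)) ≤
          d ^ 2 * ((j : ℝ) + 1 + 1) * (4 * (j + 1 + 1) * (j + 1)) := by
        rw [h4]
        calc 1 / 4 * (4 * ((j : ℝ) + 1 + 1) * (j + 1)) ≤ 1 / 4 * (2 * (j + 1) + 1) ^ 2 := by nlinarith
          _ ≤ _ := by gcongr
      exact le_of_mul_le_mul_right h3 (by positivity)
  cases j with
  | zero => norm_num [lineProb]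
  | succ j =>
    rw [div_le_iff₀ (by positivity)]
    have := key j
    push_cast
    nlinarith [sq_nonneg (lineProb (2 * (j + 1)) 0)]

lemma planeProb_nonneg (n : ℕ) (x : Fin 2 → ℤ) : 0 ≤ planeProb n x :=
  mul_nonneg (lineProb_nonneg _ _) (lineProb_nonneg _ _)

lemma planeProb_zero_right (n : ℕ) : planeProb n 0 = lineProb n 0 ^ 2 := by
  simp [planeProb, sq]

lemma planeProb_zero_left (x : Fin 2 → ℤ) : planeProb 0 x = if x = 0 then 1 else 0 := by
  have : x = 0 ↔ x 0 + x 1 = 0 ∧ x 0 - x 1 = 0 := by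
    constructor
    · rintro rfl; simp
    · rintro ⟨h1, h2⟩
      ext i
      fin_cases i <;> simp <;> omega
  simp only [planeProb, lineProb, this]
  split_ifs <;> simp_all

lemma planeProb_succ (n : ℕ) (x : Fin 2 → ℤ) :
    planeProb (n + 1) x = (∑ a, planeProb n (x + step a)) / 4 := by
  rw [Fintype.sum_prod_type]
  simp only [Fin.sum_univ_two, Fintype.sum_bool, planeProb, Pi.add_apply, step, lineProb]
  simp only [Fin.isValue, zero_ne_one, one_ne_zero, Bool.false_eq_true,
    ↓reduceIte, add_zero]
  rw [show x 0 + 1 + x 1 = x 0 + x 1 + 1 by ring, show x 0 + 1 - x 1 = x 0 - x 1 + 1 by ring,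
    show x 0 + -1 + x 1 = x 0 + x 1 - 1 by ring, show x 0 + -1 - x 1 = x 0 - x 1 - 1 by ring,
    show x 0 + (x 1 + 1) = x 0 + x 1 + 1 by ring, show x 0 - (x 1 + 1) = x 0 - x 1 - 1 by ring,
    show x 0 + (x 1 + -1) = x 0 + x 1 - 1 by ring, show x 0 - (x 1 + -1) = x 0 - x 1 + 1 by ring]
  ring

/-- The expected number of visits to the origin during the first `n` steps, started at `x`. -/
noncomputable def greenFun (n : ℕ) (x : Fin 2 → ℤ) : ℝ :=
  ∑ j ∈ Finset.range (n + 1), planeProb j x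

lemma greenFun_mono (x : Fin 2 → ℤ) : Monotone fun n => greenFun n x :=
  monotone_nat_of_le_succ fun n => by
    simp only [greenFun]
    rw [Finset.sum_range_succ _ (n + 1)]
    linarith [planeProb_nonneg (n + 1) x]

lemma greenFun_succ (n : ℕ) {x : Fin 2 → ℤ} (hx : x ≠ 0) :
    greenFun (n + 1) x = (∑ a, greenFun n (x + step a)) / 4 := by
  simp only [greenFun]
  rw [Finset.sum_range_succ', planeProb_zero_left, if_neg hx, add_zero, Finset.sum_comm,
    Finset.sum_div]
  exact Finset.sum_congr rfl fun j _ => planeProb_succ j x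

/-- First-hit decomposition of the expected number of visits to `y`. -/
lemma greenFun_le (t s : ℕ) (hst : s ≤ t) (x y : Fin 2 → ℤ) :
    greenFun s (x - y) ≤ (1 - missProb s x {y}) * greenFun t 0 := by
  induction s generalizing x with
  | zero =>
    by_cases h : x = y
    · subst h
      rw [missProb_self, sub_self, sub_zero, one_mul]
      exact greenFun_mono 0 hst
    · rw [missProb_zero_singleton h]
      simp [greenFun, planeProb_zero_left, sub_eq_zero, h]
  | succ s ih =>
    by_cases h : x = y
    · subst h
      rw [missProb_self, sub_self, sub_zero, one_mul]
      exact greenFun_mono 0 hst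
    · rw [greenFun_succ s (sub_ne_zero.2 h), missProb_succ_singleton s h]
      refine (avg_le_avg (g := fun a => (-missProb s (x + step a) {y} + 1) * greenFun t 0)
        fun a => ?_).trans (le_of_eq ?_)
      · have := ih (by omega) (x + step a)
        rw [show x - y + step a = x + step a - y by abel]
        linarith
      · rw [← Finset.sum_mul, mul_div_right_comm, avg_add_const, Finset.sum_neg_distrib]
        ring

lemma planeProb_sub_le (j D : ℕ) {x : Fin 2 → ℤ} (hx : ∀ i, |x i| ≤ (D : ℤ))
    (he : Even (x 0 + x 1)) :
    planeProb (2 * j) 0 - planeProb (2 * j) x ≤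
      2 * (1 / ((j : ℝ) + 1) - 1 / (j + 1 + (D : ℝ) ^ 2)) := by
  have habs : ∀ u : ℤ, Even u → ∃ s : ℕ, (2 * (s : ℤ)) = |u| ∧
      lineProb (2 * j) u = lineProb (2 * j) (2 * s) := by
    rintro u ⟨v, rfl⟩
    refine ⟨v.natAbs, ?_, ?_⟩
    · rw [← two_mul, abs_mul, Int.natCast_natAbs]; simp
    · rw [Int.natCast_natAbs, ← two_mul]
      rcases abs_choice v with h | h <;> rw [h]
      rw [mul_neg, lineProb_neg]
  obtain ⟨s, hs, hs'⟩ := habs _ he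
  obtain ⟨r, hr, hr'⟩ := habs (x 0 - x 1) (by
    rw [show x 0 - x 1 = x 0 + x 1 - 2 * x 1 by ring]
    exact he.sub (even_two_mul (x 1)))
  have hsr : (s : ℝ) ^ 2 + (r : ℝ) ^ 2 ≤ (D : ℝ) ^ 2 := by
    have h1 : (2 * (s : ℤ)) ^ 2 = (x 0 + x 1) ^ 2 := by rw [hs, sq_abs]
    have h2 : (2 * (r : ℤ)) ^ 2 = (x 0 - x 1) ^ 2 := by rw [hr, sq_abs]
    have h3 := sq_le_sq' (by have := (abs_le.1 (hx 0)).1; linarith) (abs_le.1 (hx 0)).2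
    have h4 := sq_le_sq' (by have := (abs_le.1 (hx 1)).1; linarith) (abs_le.1 (hx 1)).2
    have : (s : ℤ) ^ 2 + (r : ℤ) ^ 2 ≤ (D : ℤ) ^ 2 := by nlinarith
    exact_mod_cast this
  have hx' : planeProb (2 * j) x = lineProb (2 * j) (2 * s) * lineProb (2 * j) (2 * r) := by
    rw [planeProb, hs', hr']
  have h1 := lineProb_two_mul_ge j s
  have h2 := lineProb_two_mul_ge j r
  have h3 := lineProb_two_mul_le j r
  have h4 := lineProb_zero_sq_le j
  have h5 := lineProb_nonneg (2 * j) (2 * s)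
  have h6 := lineProb_nonneg (2 * j) (2 * r)
  have h7 := lineProb_nonneg (2 * j) 0
  rw [planeProb_zero_right, hx']
  set c := lineProb (2 * j) 0
  set α := lineProb (2 * j) (2 * s)
  set β := lineProb (2 * j) (2 * r)
  have hj : (0 : ℝ) < j + 1 := by positivity
  have hA : c ^ 2 - α * β ≤ 1 / ((j : ℝ) + 1) := by nlinarith [mul_nonneg h5 h6]
  have hB : c ^ 2 - α * β ≤ (D : ℝ) ^ 2 / (j + 1) * (1 / (j + 1)) := by
    have e1 : c * (c - β) ≤ c ^ 2 * ((r : ℝ) ^ 2 / (j + 1)) := by nlinarith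
    have e2 : β * (c - α) ≤ c * (c * ((s : ℝ) ^ 2 / (j + 1))) := by
      have : c - α ≤ c * ((s : ℝ) ^ 2 / (j + 1)) := by linarith
      have h8 : 0 ≤ c * ((s : ℝ) ^ 2 / (j + 1)) := by positivity
      calc β * (c - α) ≤ β * (c * ((s : ℝ) ^ 2 / (j + 1))) := by gcongr
        _ ≤ _ := by gcongr
    have e3 : c ^ 2 - α * β ≤ c ^ 2 * (((s : ℝ) ^ 2 + (r : ℝ) ^ 2) / (j + 1)) := by
      rw [add_div]; nlinarith
    refine e3.trans ?_
    rw [mul_comm]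
    gcongr
  have hD : (0 : ℝ) ≤ (D : ℝ) ^ 2 := by positivity
  set d := (D : ℝ) ^ 2
  set a := (j : ℝ) + 1
  have hrhs : 2 * (1 / a - 1 / (a + d)) = 2 * d / (a * (a + d)) := by
    field_simp
    ring
  rw [hrhs]
  rcases le_total a d with h | h
  · refine hA.trans ?_
    rw [div_le_div_iff₀ hj (by positivity)]
    nlinarith
  · refine hB.trans ?_
    rw [div_mul_div_comm, mul_one, div_le_div_iff₀ (by positivity) (by positivity)]
    nlinarith [mul_nonneg hD (mul_nonneg hj.le (sub_nonneg.2 h))]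

lemma sum_inv_sub_inv_le (N d : ℕ) :
    ∑ j ∈ Finset.range N, (1 / ((j : ℝ) + 1) - 1 / (j + 1 + d)) ≤ (harmonic d : ℝ) := by
  have key : ∑ j ∈ Finset.range N, (1 / ((j : ℝ) + 1) - 1 / (j + 1 + d)) =
      ∑ j ∈ Finset.range d, (1 / ((j : ℝ) + 1) - 1 / (j + 1 + N)) := by
    have h : ∀ a b : ℕ, ∑ j ∈ Finset.range a, (1 / ((j : ℝ) + 1) - 1 / (j + 1 + b)) =
        ∑ j ∈ Finset.range a, 1 / ((j : ℝ) + 1) + ∑ j ∈ Finset.range b, 1 / ((j : ℝ) + 1) -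
        ∑ j ∈ Finset.range (a + b), 1 / ((j : ℝ) + 1) := by
      intro a b
      rw [Finset.sum_sub_distrib, add_comm a b, Finset.sum_range_add]
      have : ∀ j : ℕ, 1 / ((j : ℝ) + 1 + b) = 1 / (((b + j : ℕ) : ℝ) + 1) := by
        intro j; push_cast; ring
      simp only [this]
      ring
    rw [h, h, add_comm d N]
    ring
  rw [key, harmonic]
  push_cast
  refine Finset.sum_le_sum fun j _ => ?_
  rw [one_div]
  have : (0 : ℝ) ≤ 1 / (j + 1 + N) := by positivity
  linarith

lemma greenFun_two_mul (N : ℕ) (x : Fin 2 → ℤ) :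
    greenFun (2 * N) x = ∑ j ∈ Finset.range (N + 1), planeProb (2 * j) x +
      ∑ j ∈ Finset.range N, planeProb (2 * j + 1) x := by
  induction N with
  | zero => simp [greenFun]
  | succ N ih =>
    rw [greenFun, show 2 * (N + 1) + 1 = 2 * N + 1 + 1 + 1 by ring, Finset.sum_range_succ,
      Finset.sum_range_succ, ← greenFun, ih,
      Finset.sum_range_succ (fun j => planeProb (2 * j) x) (N + 1),
      Finset.sum_range_succ (fun j => planeProb (2 * j + 1) x) N, mul_add_one]
    ring

lemma log_le_greenFun_zero (N : ℕ) : Real.log (N + 2) / 4 ≤ greenFun (2 * N) 0 := by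
  have h1 := log_add_one_le_harmonic (N + 1)
  rw [greenFun_two_mul]
  have h2 : ∀ j ∈ Finset.range (N + 1), 1 / 4 * (((j : ℝ) + 1)⁻¹) ≤ planeProb (2 * j) 0 := by
    intro j _
    rw [planeProb_zero_right]
    refine le_trans (le_of_eq ?_) (lineProb_zero_sq_ge j)
    field_simp
  have h3 := Finset.sum_le_sum h2
  have h4 : 0 ≤ ∑ j ∈ Finset.range N, planeProb (2 * j + 1) 0 :=
    Finset.sum_nonneg fun j _ => planeProb_nonneg _ _
  rw [← Finset.mul_sum] at h3
  have h5 : ((harmonic (N + 1) : ℚ) : ℝ) = ∑ j ∈ Finset.range (N + 1), ((j : ℝ) + 1)⁻¹ := by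
    rw [harmonic]; push_cast; rfl
  rw [h5] at h1
  push_cast at h1
  rw [show (N : ℝ) + 1 + 1 = N + 2 by ring] at h1
  linarith

lemma greenFun_zero_sub_le (N D : ℕ) {x : Fin 2 → ℤ} (hx : ∀ i, |x i| ≤ (D : ℤ))
    (he : Even (x 0 + x 1)) :
    greenFun (2 * N) 0 - greenFun (2 * N) x ≤ 2 * (1 + 2 * Real.log D) := by
  rw [greenFun_two_mul, greenFun_two_mul]
  have h1 : ∑ j ∈ Finset.range N, planeProb (2 * j + 1) 0 = 0 :=
    Finset.sum_eq_zero fun j _ => by rw [planeProb_zero_right, lineProb_zero_odd]; simp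
  have h2 : 0 ≤ ∑ j ∈ Finset.range N, planeProb (2 * j + 1) x :=
    Finset.sum_nonneg fun j _ => planeProb_nonneg _ _
  have h3 := Finset.sum_le_sum fun j (_ : j ∈ Finset.range (N + 1)) => planeProb_sub_le j D hx he
  rw [Finset.sum_sub_distrib, ← Finset.mul_sum] at h3
  have h4 := sum_inv_sub_inv_le (N + 1) (D ^ 2)
  have h5 := harmonic_le_one_add_log (D ^ 2)
  push_cast at h4 h5
  rw [Real.log_pow] at h5
  push_cast at h5
  linarith

lemma missProb_le_of_even (N D : ℕ) {x y : Fin 2 → ℤ} (hx : ∀ i, |x i - y i| ≤ (D : ℤ))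
    (he : Even (x 0 - y 0 + (x 1 - y 1))) :
    missProb (2 * N) x {y} ≤ 8 * (1 + 2 * Real.log D) / Real.log (N + 2) := by
  have h1 := greenFun_le (2 * N) (2 * N) le_rfl x y
  have h2 := greenFun_zero_sub_le N D (x := x - y) hx he
  have h3 := log_le_greenFun_zero N
  have h4 : 0 < Real.log (N + 2) := Real.log_pos (by linarith [Nat.cast_nonneg (α := ℝ) N])
  rw [le_div_iff₀ h4]
  have h5 : missProb (2 * N) x {y} * greenFun (2 * N) 0 ≤ 2 * (1 + 2 * Real.log D) := by
    linarith
  have h6 := mul_le_mul_of_nonneg_left h3 (missProb_nonneg (2 * N) x {y})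
  linarith

/-- A point at distance at most `D` is missed for `n` steps with probability
`O(log D / log n)`. -/
lemma missProb_singleton_le {n D : ℕ} (hn : 2 ≤ n) (hD : 2 ≤ D) {x y : Fin 2 → ℤ}
    (hx : ∀ i, |x i - y i| ≤ (D : ℤ)) :
    missProb n x {y} ≤ 128 * Real.log D / Real.log n := by
  obtain ⟨N, hN1, hN2⟩ : ∃ N, 2 * N + 1 ≤ n ∧ n ≤ 2 * N + 2 := ⟨(n - 1) / 2, by omega, by omega⟩
  have hlogN : 0 < Real.log (N + 2) := Real.log_pos (by linarith [Nat.cast_nonneg (α := ℝ) N])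
  have hlogn : 0 < Real.log n := Real.log_pos (by exact_mod_cast hn)
  have hD' : (2 : ℝ) ≤ D := by exact_mod_cast hD
  have hlogD : Real.log 2 ≤ Real.log D := Real.log_le_log (by norm_num) hD'
  have hlog2 := Real.log_two_gt_d9
  have h2 : Real.log n ≤ 2 * Real.log (N + 2) := by
    have : Real.log n ≤ Real.log ((N + 2) ^ 2) := by
      refine Real.log_le_log (by positivity) ?_
      exact_mod_cast (by nlinarith : n ≤ (N + 2) ^ 2)
    rwa [Real.log_pow, Nat.cast_ofNat] at this
  have h3 : Real.log (D + 1 : ℕ) ≤ 2 * Real.log D := by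
    have : Real.log (D + 1 : ℕ) ≤ Real.log (D ^ 2) := by
      refine Real.log_le_log (by positivity) ?_
      exact_mod_cast (by nlinarith : D + 1 ≤ D ^ 2)
    rwa [Real.log_pow, Nat.cast_ofNat] at this
  have key : missProb (2 * N + 1) x {y} ≤ 8 * (1 + 2 * Real.log (D + 1 : ℕ)) / Real.log (N + 2) := by
    by_cases he : Even (x 0 - y 0 + (x 1 - y 1))
    · exact (missProb_succ_le _ _ _).trans (missProb_le_of_even N (D + 1)
        (fun i => (hx i).trans (by push_cast; linarith)) he)
    · by_cases hxy : x = y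
      · subst hxy; simp at he
      rw [missProb_succ_singleton _ hxy]
      refine avg_le_of_forall_le fun a => missProb_le_of_even N (D + 1) (fun i => ?_) ?_
      · have h1 := abs_le.1 (hx i)
        have h2 := abs_le.1 (abs_step_le a i)
        rw [Pi.add_apply, abs_le]
        push_cast
        constructor <;> linarith [h1.1, h1.2, h2.1, h2.2]
      · rw [Int.not_even_iff_odd] at he
        have hs : Odd (step a 0 + step a 1) := by
          rcases a with ⟨i, b⟩
          fin_cases i <;> cases b <;> simp [step]
        rw [Pi.add_apply, Pi.add_apply, show x 0 + step a 0 - y 0 + (x 1 + step a 1 - y 1) =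
          x 0 - y 0 + (x 1 - y 1) + (step a 0 + step a 1) by ring]
        exact he.add_odd hs
  refine (missProb_antitone x {y} hN1).trans (key.trans ?_)
  rw [div_le_div_iff₀ hlogN hlogn]
  have h4 : 8 * (1 + 2 * Real.log (D + 1 : ℕ)) ≤ 64 * Real.log D := by linarith
  calc 8 * (1 + 2 * Real.log (D + 1 : ℕ)) * Real.log n
      ≤ 64 * Real.log D * (2 * Real.log (N + 2)) := by gcongr
    _ = _ := by ring

/-! Covering a square. -/

/-- The finite set of points of the square of radius `r` around the origin. -/
noncomputable def squareFinset (r : ℕ) : Finset (Fin 2 → ℤ) :=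
  Fintype.piFinset fun _ => Finset.Icc (-(r : ℤ)) r

lemma mem_squareFinset {r : ℕ} {x : Fin 2 → ℤ} : x ∈ squareFinset r ↔ ∀ i, |x i| ≤ (r : ℤ) := by
  simp [squareFinset, abs_le]

lemma card_squareFinset (r : ℕ) : (squareFinset r).card = (2 * r + 1) ^ 2 := by
  simp only [squareFinset, Fintype.card_piFinset, Int.card_Icc, Finset.prod_const,
    Finset.card_univ, Fintype.card_fin]
  congr 1
  omega

/-- If each point of `B` is missed by an `L`-step walk from the origin with probability at most
`1 / 2`, and every point at distance at most `L` from the origin hits the origin and every point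
of `B` is hit from the origin within `s` steps up to an error `δ`, then `m` rounds of `L` steps
followed by a return to the origin leave on average a proportion `2 ^ (-m)` of `B` uncovered. -/
lemma missProb_rounds_le {L s : ℕ} {δ : ℝ} {A : Finset (Fin 2 → ℤ)}
    (hhalf : ∀ y ∈ A, missProb L 0 {y} ≤ 1 / 2)
    (hret : ∀ w : Fin 2 → ℤ, (∀ i, |w i| ≤ (L : ℤ)) → missProb s w {0} ≤ δ)
    (hhit : ∀ y ∈ A, missProb s 0 {y} ≤ δ) (m : ℕ) {B : Finset (Fin 2 → ℤ)} (hB : B ⊆ A) :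
    missProb (m * (L + s) + s) 0 B ≤ m * δ + δ / 2 ^ m * B.card := by
  have hδ : 0 ≤ δ := (missProb_nonneg _ _ _).trans (hret 0 (by simp))
  induction m generalizing B with
  | zero =>
    simp only [zero_mul, zero_add, Nat.cast_zero, pow_zero, div_one]
    refine (missProb_le_sum s 0 B).trans ?_
    have := Finset.sum_le_card_nsmul B _ δ fun y hy => hhit y (hB hy)
    rwa [nsmul_eq_mul, mul_comm] at this
  | succ m ih =>
    have h := missProb_le_of_markov (t := s + (m * (L + s) + s)) (α := δ + m * δ)
      (β := δ / 2 ^ m) (by positivity) L 0 B fun B' hB' w hw => by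
        have h1 := hret w (by simpa using hw)
        have h2 := missProb_le_of_hit (ih (hB'.trans hB)) s w
        linarith
    rw [show (m + 1) * (L + s) + s = L + (s + (m * (L + s) + s)) by ring]
    refine h.trans ?_
    have h3 := Finset.sum_le_card_nsmul B (fun y => missProb L 0 {y}) (1 / 2)
      fun y hy => hhalf y (hB hy)
    rw [nsmul_eq_mul] at h3
    have h4 := mul_le_mul_of_nonneg_left h3 (show 0 ≤ δ / 2 ^ m by positivity)
    rw [pow_succ]
    push_cast
    calc _ ≤ δ + m * δ + δ / 2 ^ m * (B.card * (1 / 2)) := by linarith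
      _ = _ := by field_simp; ring

lemma boundary_event_subset {n k : ℕ} (z : Fin 2 → ℤ) :
    {ω : Fin n → Fin 2 × Bool | ∃ x ∈ innerBdry (rangeW z ω), x ∈ square 0 k} ⊆
      {ω | ¬ squareFinset (k + 1) ⊆ rangeW z ω} := by
  rintro ω ⟨x, hx, hxk⟩ hsub
  obtain ⟨-, a, ha⟩ := Finset.mem_filter.1 hx
  refine ha (hsub (mem_squareFinset.2 fun i => ?_))
  have h1 := abs_le.1 (hxk i)
  have h2 := abs_le.1 (abs_step_le a i)
  simp only [Pi.zero_apply, sub_zero] at h1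
  rw [Pi.add_apply, abs_le]
  push_cast
  constructor <;> linarith [h1.1, h1.2, h2.1, h2.2]

/-- The probability of not covering the square of radius `k + 1`, when `n` is a large power
of `k`. -/
lemma missProb_square_le {n k : ℕ} (hk : 2 ≤ k) (hn : k ^ 1536 ≤ n) {z : Fin 2 → ℤ}
    (hz : ∀ i, |z i| ≤ ((k + 1 : ℕ) : ℤ)) :
    missProb n z (squareFinset (k + 1)) ≤ 7864320 * Real.log k ^ 2 / Real.log n := by
  obtain ⟨L, hL⟩ : ∃ L, L = k ^ 768 := ⟨_, rfl⟩
  obtain ⟨s, hs⟩ : ∃ s, s = Nat.sqrt n := ⟨_, rfl⟩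
  obtain ⟨l, hl⟩ : ∃ l, l = Nat.log 2 k := ⟨_, rfl⟩
  have hk1 : 1 ≤ k := by omega
  have hpow : ∀ i, i ≤ 768 → k ^ i ≤ L := fun i hi => hL ▸ Nat.pow_le_pow_right hk1 hi
  have hLs : L ≤ s := by
    rw [hs, Nat.le_sqrt', hL, ← pow_mul]; exact hn
  have hk3 : k + 1 ≤ k ^ 3 := by nlinarith [Nat.mul_le_mul hk hk, Nat.pow_le_pow_left hk 3]
  have h8 : 2 ≤ k ^ 3 := by omega
  have hL2 : 2 ≤ L := h8.trans (hpow 3 (by norm_num))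
  have hs2 : 2 ≤ s := hL2.trans hLs
  have hlogk : 0 < Real.log k := Real.log_pos (by exact_mod_cast hk)
  have hlogs : 0 < Real.log s := Real.log_pos (by exact_mod_cast hs2)
  have hsq : s ^ 2 ≤ n := hs ▸ Nat.sqrt_le' n
  have hn2 : 2 ≤ n := by nlinarith
  have hlogn : 0 < Real.log n := Real.log_pos (by exact_mod_cast hn2)
  have hlogL : Real.log L = 768 * Real.log k := by
    rw [hL, Nat.cast_pow, Real.log_pow, Nat.cast_ofNat]
  have hlogk3 : Real.log (k ^ 3 : ℕ) = 3 * Real.log k := by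
    push_cast; rw [Real.log_pow]; norm_num
  set δ := 128 * Real.log L / Real.log s with hδ
  have hδ0 : 0 ≤ δ := by rw [hδ, hlogL]; positivity
  have hret : ∀ w : Fin 2 → ℤ, (∀ i, |w i| ≤ (L : ℤ)) → missProb s w {0} ≤ δ := fun w hw =>
    missProb_singleton_le hs2 hL2 (by simpa using hw)
  have hbd : ∀ y ∈ squareFinset (k + 1), ∀ i, |(0 : Fin 2 → ℤ) i - y i| ≤ ((k ^ 3 : ℕ) : ℤ) := by
    intro y hy i
    simp only [Pi.zero_apply, zero_sub, abs_neg]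
    exact (mem_squareFinset.1 hy i).trans (by exact_mod_cast hk3)
  have hhalf : ∀ y ∈ squareFinset (k + 1), missProb L 0 {y} ≤ 1 / 2 := by
    intro y hy
    refine (missProb_singleton_le hL2 h8 (hbd y hy)).trans (le_of_eq ?_)
    rw [hlogk3, hlogL]
    field_simp
    norm_num
  have hhit : ∀ y ∈ squareFinset (k + 1), missProb s 0 {y} ≤ δ := fun y hy =>
    missProb_singleton_le hs2 hL2 fun i =>
      (hbd y hy i).trans (by exact_mod_cast hpow 3 (by norm_num))
  have hround := missProb_rounds_le hhalf hret hhit (2 * l + 6) (Finset.Subset.refl _)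
  have hz0 := hret z fun i => (hz i).trans (by exact_mod_cast hk3.trans (hpow 3 (by norm_num)))
  have hall := missProb_le_of_hit hround s z
  have hlk : l ≤ k := hl ▸ Nat.log_le_self 2 k
  have htime : s + ((2 * l + 6) * (L + s) + s) ≤ n := by
    have h1 : 4 * k + 14 ≤ k ^ 5 := by
      have : 2 ^ 4 ≤ k ^ 4 := Nat.pow_le_pow_left hk 4
      have h3 : k ^ 5 = k ^ 4 * k := pow_succ k 4
      nlinarith
    have h2 : 4 * l + 14 ≤ s := by
      have := (h1.trans (hpow 5 (by norm_num))).trans hLs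
      omega
    calc s + ((2 * l + 6) * (L + s) + s) ≤ s + ((2 * l + 6) * (s + s) + s) := by gcongr
      _ = (4 * l + 14) * s := by ring
      _ ≤ s * s := by gcongr
      _ ≤ n := by rw [← sq]; exact hsq
  have hcard : ((squareFinset (k + 1)).card : ℝ) ≤ 2 ^ (2 * l + 6) := by
    rw [card_squareFinset]
    have h1 : k < 2 ^ (l + 1) := hl ▸ Nat.lt_pow_succ_log_self (by norm_num) k
    have h2 : 2 * (k + 1) + 1 ≤ 2 ^ (l + 3) := by
      rw [show l + 3 = (l + 1) + 2 by ring, pow_add]; omega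
    rw [show 2 * l + 6 = (l + 3) * 2 by ring, pow_mul]
    exact_mod_cast Nat.pow_le_pow_left h2 2
  have hcard' : δ / 2 ^ (2 * l + 6) * ((squareFinset (k + 1)).card : ℝ) ≤ δ := by
    rw [div_mul_eq_mul_div, div_le_iff₀ (by positivity)]
    gcongr
  have hlog2 := Real.log_two_gt_d9
  have hl2 : (l : ℝ) ≤ 2 * Real.log k := by
    have h1 : 2 ^ l ≤ k := hl ▸ Nat.pow_log_le_self 2 (by omega)
    have h2 : Real.log (2 ^ l) ≤ Real.log k :=
      Real.log_le_log (by positivity) (by exact_mod_cast h1)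
    rw [Real.log_pow] at h2
    nlinarith [Nat.cast_nonneg (α := ℝ) l]
  have hk2 : (1 : ℝ) ≤ 2 * Real.log k := by
    have : Real.log 2 ≤ Real.log k := Real.log_le_log (by norm_num) (by exact_mod_cast hk)
    linarith
  have hsn : Real.log n ≤ 4 * Real.log s := by
    have h1 : n < (s + 1) ^ 2 := hs ▸ Nat.lt_succ_sqrt' n
    have h2 : n ≤ s ^ 4 := by
      have : s + 1 ≤ s ^ 2 := by nlinarith
      calc n ≤ (s + 1) ^ 2 := h1.le
        _ ≤ (s ^ 2) ^ 2 := by gcongr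
        _ = s ^ 4 := by ring
    have h3 : Real.log n ≤ Real.log (s ^ 4) :=
      Real.log_le_log (by positivity) (by exact_mod_cast h2)
    rwa [Real.log_pow, Nat.cast_ofNat] at h3
  push_cast at hall
  have hδn : δ ≤ 393216 * Real.log k / Real.log n := by
    rw [hδ, hlogL, div_le_div_iff₀ hlogs hlogn]
    nlinarith
  calc missProb n z (squareFinset (k + 1)) ≤ _ := missProb_antitone z _ htime
    _ ≤ (2 * l + 8) * δ := by linarith
    _ ≤ (20 * Real.log k) * (393216 * Real.log k / Real.log n) := by
      gcongr
      linarith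
    _ = _ := by ring

/-- For `z` at graph distance 1 from the square `Q(0,k)`, the walk started at `z` satisfies
`P_z[∂R(n) ∩ Q(0,k) ≠ ∅] ≤ C (log k)² / log n`. -/
theorem prob_boundary_in_square :
    ∃ C : ℝ, 0 < C ∧ ∀ n k : ℕ, 2 ≤ n → 2 ≤ k →
      ∀ z : Fin 2 → ℤ, z ∉ square 0 k → (∃ a : Fin 2 × Bool, z + step a ∈ square 0 k) →
      prW 2 n {ω | ∃ x ∈ innerBdry (rangeW z ω), x ∈ square 0 k} ≤
        C * (Real.log k) ^ 2 / Real.log n := by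
  refine ⟨7864320, by norm_num, fun n k hn hk z _ ⟨a, ha⟩ => ?_⟩
  have hlogn : 0 < Real.log n := Real.log_pos (by exact_mod_cast hn)
  have hle : prW 2 n {ω | ∃ x ∈ innerBdry (rangeW z ω), x ∈ square 0 k} ≤
      missProb n z (squareFinset (k + 1)) :=
    (prW_mono (boundary_event_subset z)).trans (prW_not_subset_rangeW n z _).le
  refine hle.trans ?_
  by_cases hnk : k ^ 1536 ≤ n
  · refine missProb_square_le hk hnk fun i => ?_
    have h1 := abs_le.1 (ha i)
    have h2 := abs_le.1 (abs_step_le a i)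
    simp only [Pi.add_apply, Pi.zero_apply, sub_zero] at h1
    rw [abs_le]
    push_cast
    constructor <;> linarith [h1.1, h1.2, h2.1, h2.2]
  · refine (missProb_le_one _ _ _).trans ?_
    rw [le_div_iff₀ hlogn, one_mul]
    have h1 : Real.log n ≤ Real.log (k ^ 1536) :=
      Real.log_le_log (by positivity) (by exact_mod_cast (not_le.1 hnk).le)
    rw [Real.log_pow] at h1
    have h2 : Real.log 2 ≤ Real.log k := Real.log_le_log (by norm_num) (by exact_mod_cast hk)
    have h3 := Real.log_two_gt_d9
    push_cast at h1
    nlinarith
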